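/- (Shrink-back combined with asymmetric edge removal.) Let 0 < α ≤ 2π/3, let R > 0, let V be a finite set of points of the Euclidean plane, and let r : V → ℝ satisfy 0 < r u ≤ R for every u ∈ V together with the shrink-back coverage condition. Then the graph G_α⁻, which joins two distinct points u, v ∈ V iff dist u v ≤ min (r u) (r v), preserves the connectivity of G_R: for all u, v ∈ V, u and v are joined by a path in G_α⁻ if and only if they are joined by a path in G_R. -/

import Mathlib

open EuclideanGeometry Real

noncomputable section

/-- The Euclidean plane. -/
abbrev EPlane := EuclideanSpace ℝ (Fin 2)

/-- Adjacency in the graph `G_R`: two distinct points of `V` at distance at most `R`. -/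
def GRAdj (R : ℝ) (V : Finset EPlane) (u v : EPlane) : Prop :=
  u ∈ V ∧ v ∈ V ∧ u ≠ v ∧ dist u v ≤ R

/-- A radius assignment `r` is CBTC(α)-valid if every `u ∈ V` has `0 < r u ≤ R` and
either `r u = R` or `u` has no α-gap: every direction `e` is within angle `α/2`
of some neighbor of `u` at distance at most `r u`. -/
def CBTCValid (α R : ℝ) (V : Finset EPlane) (r : EPlane → ℝ) : Prop :=
  ∀ u ∈ V, (0 < r u ∧ r u ≤ R) ∧
    (r u = R ∨ ∀ e : EPlane, e ≠ 0 → ∃ v ∈ V, v ≠ u ∧ dist u v ≤ r u ∧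
      InnerProductGeometry.angle (v - u) e ≤ α / 2)

/-- Adjacency in the graph `G_α` (symmetric closure of `N_α`):
two distinct points of `V` with `dist u v ≤ max (r u) (r v)`. -/
def GAlphaAdj (V : Finset EPlane) (r : EPlane → ℝ) (u v : EPlane) : Prop :=
  u ∈ V ∧ v ∈ V ∧ u ≠ v ∧ dist u v ≤ max (r u) (r v)

/-- The shrink-back coverage condition: every direction covered within radius `R`
is also covered within radius `r u`. -/
def ShrinkBackValid (α R : ℝ) (V : Finset EPlane) (r : EPlane → ℝ) : Prop :=
  ∀ u ∈ V, ∀ e : EPlane, e ≠ 0 →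
    (∃ v ∈ V, v ≠ u ∧ dist u v ≤ R ∧ InnerProductGeometry.angle (v - u) e ≤ α / 2) →
    ∃ v' ∈ V, v' ≠ u ∧ dist u v' ≤ r u ∧ InnerProductGeometry.angle (v' - u) e ≤ α / 2

/-- Adjacency in `G_α⁻`: two distinct points of `V` with
`dist u v ≤ min (r u) (r v)`. -/
def GAlphaMinusAdj (V : Finset EPlane) (r : EPlane → ℝ) (u v : EPlane) : Prop :=
  u ∈ V ∧ v ∈ V ∧ u ≠ v ∧ dist u v ≤ min (r u) (r v)

/-- If `w` is strictly closer to `u` than `v` is, and is seen from `u` within angle `π / 3` of `v`,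
then `w` is strictly closer to `v` than `u` is. -/
theorem dist_lt_of_angle_le_pi_div_three {E : Type*} [NormedAddCommGroup E]
    [InnerProductSpace ℝ E] {u v w : E} (hwu : w ≠ u) (hlt : dist u w < dist u v)
    (hangle : InnerProductGeometry.angle (w - u) (v - u) ≤ Real.pi / 3) :
    dist w v < dist u v := by
  have hcos : 1 / 2 ≤ Real.cos (InnerProductGeometry.angle (w - u) (v - u)) := by
    rw [← Real.cos_pi_div_three]
    exact Real.cos_le_cos_of_nonneg_of_le_pi (InnerProductGeometry.angle_nonneg _ _)
      (by linarith [Real.pi_pos]) hangle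
  have hlaw := InnerProductGeometry.norm_sub_sq_eq_norm_sq_add_norm_sq_sub_two_mul_norm_mul_norm_mul_cos_angle
    (w - u) (v - u)
  rw [sub_sub_sub_cancel_right, ← dist_eq_norm, ← dist_eq_norm, ← dist_eq_norm,
    dist_comm w u, dist_comm v u] at hlaw
  have hpos : 0 < dist u w := dist_pos.2 hwu.symm
  have hmul := mul_le_mul_of_nonneg_left hcos (mul_nonneg hpos.le (hpos.trans hlt).le)
  refine lt_of_pow_lt_pow_left₀ 2 dist_nonneg ?_
  nlinarith [mul_pos hpos (sub_pos.2 hlt)]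

/-- Strong induction on the distance between two points of a finite set. -/
theorem Finset.dist_induction {X : Type*} [PseudoMetricSpace X] (V : Finset X) {P : X → X → Prop}
    (h : ∀ u ∈ V, ∀ v ∈ V,
      (∀ u' ∈ V, ∀ v' ∈ V, dist u' v' < dist u v → P u' v') → P u v) :
    ∀ u ∈ V, ∀ v ∈ V, P u v := by
  have hwf : (↑(V ×ˢ V) : Set (X × X)).WellFoundedOn
      (fun p q => dist p.1 p.2 < dist q.1 q.2) := by
    have : IsStrictOrder (X × X) (fun p q => dist p.1 p.2 < dist q.1 q.2) :=
      { irrefl := fun _ => lt_irrefl _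
        trans := fun _ _ _ => lt_trans }
    exact (V ×ˢ V).finite_toSet.wellFoundedOn
  intro u hu v hv
  refine hwf.induction (P := fun p => P p.1 p.2) (x := (u, v)) (by simp [hu, hv]) ?_
  rintro ⟨a, b⟩ hab ih
  obtain ⟨ha, hb⟩ : a ∈ V ∧ b ∈ V := by simpa using hab
  exact h a ha b hb fun u' hu' v' hv' hlt => ih (u', v') (by simp [hu', hv']) hlt

/-- A far neighbor of `u` can be traded for one within radius `r u` that is closer to both. -/
theorem ShrinkBackValid.exists_closer {α R : ℝ} {V : Finset EPlane} {r : EPlane → ℝ}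
    (hα : 0 < α) (hα' : α ≤ 2 * Real.pi / 3) (hsb : ShrinkBackValid α R V r) {u v : EPlane}
    (hu : u ∈ V) (hv : v ∈ V) (huv : u ≠ v) (hR : dist u v ≤ R) (hlt : r u < dist u v) :
    ∃ w ∈ V, dist u w < dist u v ∧ dist w v < dist u v := by
  have hne : v - u ≠ 0 := sub_ne_zero.2 huv.symm
  obtain ⟨w, hw, hwu, hd, hangle⟩ := hsb u hu (v - u) hne
    ⟨v, hv, huv.symm, hR, by rw [InnerProductGeometry.angle_self hne]; positivity⟩
  exact ⟨w, hw, hd.trans_lt hlt,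
    dist_lt_of_angle_le_pi_div_three hwu (hd.trans_lt hlt) (by linarith)⟩

/-- Points of `V` at distance at most `R` are joined by a path in `G_α⁻`. -/
theorem ShrinkBackValid.reflTransGen_of_dist_le {α R : ℝ} {V : Finset EPlane} {r : EPlane → ℝ}
    (hα : 0 < α) (hα' : α ≤ 2 * Real.pi / 3) (hsb : ShrinkBackValid α R V r) :
    ∀ u ∈ V, ∀ v ∈ V, dist u v ≤ R → Relation.ReflTransGen (GAlphaMinusAdj V r) u v := by
  refine V.dist_induction fun u hu v hv ih hR => ?_
  rcases eq_or_ne u v with rfl | huv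
  · exact .refl
  have split : ∀ w ∈ V, dist u w < dist u v → dist w v < dist u v →
      Relation.ReflTransGen (GAlphaMinusAdj V r) u v := fun w hw h₁ h₂ =>
    (ih u hu w hw h₁ (h₁.le.trans hR)).trans (ih w hw v hv h₂ (h₂.le.trans hR))
  rcases lt_or_ge (r u) (dist u v) with hlt | hru
  · obtain ⟨w, hw, h₁, h₂⟩ := hsb.exists_closer hα hα' hu hv huv hR hlt
    exact split w hw h₁ h₂
  rcases lt_or_ge (r v) (dist u v) with hlt | hrv
  · rw [dist_comm] at hR hlt
    obtain ⟨w, hw, h₁, h₂⟩ := hsb.exists_closer hα hα' hv hu huv.symm hR hlt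
    refine split w hw ?_ ?_
    · rwa [dist_comm u w, dist_comm u v]
    · rwa [dist_comm w v, dist_comm u v]
  · exact .single ⟨hu, hv, huv, le_min hru hrv⟩

/-- Shrink-back combined with asymmetric edge removal: for `0 < α ≤ 2π/3` and a
radius assignment satisfying `0 < r u ≤ R` and the shrink-back coverage
condition, `G_α⁻` preserves the connectivity of `G_R`. -/
theorem cbtc_shrink_back_asymmetric_connectivity (α R : ℝ) (hα : 0 < α)
    (hα' : α ≤ 2 * Real.pi / 3) (hR : 0 < R) (V : Finset EPlane) (r : EPlane → ℝ)
    (hr : ∀ u ∈ V, 0 < r u ∧ r u ≤ R) (hsb : ShrinkBackValid α R V r)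
    (u v : EPlane) (hu : u ∈ V) (hv : v ∈ V) :
    Relation.ReflTransGen (GAlphaMinusAdj V r) u v ↔
      Relation.ReflTransGen (GRAdj R V) u v := by
  constructor
  · refine Relation.ReflTransGen.mono (fun a b h => ?_) u v
    obtain ⟨ha, hb, hab, hd⟩ := h
    exact ⟨ha, hb, hab, hd.trans ((min_le_left _ _).trans (hr a ha).2)⟩
  · intro h
    induction h with
    | refl => exact .refl
    | tail _ hadj ih =>
      obtain ⟨hb, hc, -, hd⟩ := hadj
      exact (ih hb).trans (hsb.reflTransGen_of_dist_le hα hα' _ hb _ hc hd)
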